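/- (Ring lemma.) Let n ≥ 3 and let I(e) > 1 be weights on the edges of the star triangulation of an n-gon. There exists a constant C = C(I, n) > 0 such that every generalized inversive distance circle packing r = (r₀, r₁, …, r_n) on this star triangulation that is flat at the interior vertex, i.e. K₀(r) = 0, satisfies r₀ ≤ C · r_i for all i = 1, …, n. -/

import Mathlib

/-- Inversive distance edge length for radii `a, b` and weight `I` on the edge. -/
noncomputable def lenr (I a b : ℝ) : ℝ :=
  Real.sqrt (a ^ 2 + b ^ 2 + 2 * a * b * I)

/-- Inner angle opposite the side of length `c` in a (generalized) triangle with
adjacent side lengths `a, b`. -/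
noncomputable def ang0 (a b c : ℝ) : ℝ :=
  Real.arccos ((a ^ 2 + b ^ 2 - c ^ 2) / (2 * a * b))

/-- Length of the spoke edge `v₀vᵢ` in the star triangulation: `I0 i` is the weight
on `v₀vᵢ`, `r0` the radius at `v₀` and `r i` the radius at `vᵢ`. -/
noncomputable def spoke {n : ℕ} (I0 : Fin n → ℝ) (r0 : ℝ) (r : Fin n → ℝ) (i : Fin n) : ℝ :=
  lenr (I0 i) r0 (r i)

/-- Length of the boundary edge `vᵢv_{i+1}` (indices mod `n`): `Ib i` is the weight on it. -/
noncomputable def bd {n : ℕ} [NeZero n] (Ib : Fin n → ℝ) (r : Fin n → ℝ) (i : Fin n) : ℝ :=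
  lenr (Ib i) (r i) (r (i + 1))

/-- `(r0, r)` is a generalized inversive distance circle packing on the star
triangulation: each triangle `v₀vᵢv_{i+1}` satisfies the non-strict triangle
inequalities. -/
def genPacking {n : ℕ} [NeZero n] (I0 Ib : Fin n → ℝ) (r0 : ℝ) (r : Fin n → ℝ) : Prop :=
  ∀ i : Fin n,
    spoke I0 r0 r i ≤ spoke I0 r0 r (i + 1) + bd Ib r i ∧
    spoke I0 r0 r (i + 1) ≤ spoke I0 r0 r i + bd Ib r i ∧
    bd Ib r i ≤ spoke I0 r0 r i + spoke I0 r0 r (i + 1)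

/-- Combinatorial curvature at the interior vertex `v₀`: `2π` minus the sum of the
angles at `v₀` of the triangles `v₀vᵢv_{i+1}`. -/
noncomputable def curv0 {n : ℕ} [NeZero n] (I0 Ib : Fin n → ℝ) (r0 : ℝ) (r : Fin n → ℝ) : ℝ :=
  2 * Real.pi - ∑ i : Fin n, ang0 (spoke I0 r0 r i) (spoke I0 r0 r (i + 1)) (bd Ib r i)


theorem lenr_le_add_mul {I a b : ℝ} (hI : 1 ≤ I) (ha : 0 ≤ a) (hb : 0 ≤ b) :
    lenr I a b ≤ a + b * I := by
  unfold lenr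
  rw [Real.sqrt_le_left (by positivity)]
  nlinarith [mul_nonneg (sq_nonneg b) (show 0 ≤ I ^ 2 - 1 by nlinarith)]

theorem lenr_sq {I a b : ℝ} (hI : 1 ≤ I) (ha : 0 ≤ a) (hb : 0 ≤ b) :
    lenr I a b ^ 2 = a ^ 2 + b ^ 2 + 2 * a * b * I :=
  Real.sq_sqrt (by positivity)

theorem le_lenr {I a b : ℝ} (hI : 1 ≤ I) (ha : 0 ≤ a) (hb : 0 ≤ b) : a ≤ lenr I a b := by
  refine Real.le_sqrt_of_sq_le ?_
  have : 0 ≤ a * b * I := by positivity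
  nlinarith [sq_nonneg b]

/-- If one boundary radius is small compared with `r₀`, the triangle inequality forces the
neighbouring radius to be comparably small. -/
theorem mul_le_of_lenr_le {J K L B m r0 a b : ℝ} (hm : 0 < m) (hm2 : m ≤ 2) (hJ : m ≤ J - 1)
    (hK : 1 ≤ K) (hL : 1 ≤ L) (hKB : K ≤ B) (hLB : L ≤ B) (hr0 : 0 < r0) (ha : 0 < a)
    (hb : 0 < b) (hsmall : 4 * B * a ≤ m * r0)
    (h : lenr J r0 b ≤ lenr K r0 a + lenr L a b) : b * m ≤ 6 * B * a := by
  set s := 2 * B * a with hs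
  have hB : 1 ≤ B := hK.trans hKB
  have hs0 : 0 ≤ s := by positivity
  have h1 : lenr K r0 a ≤ r0 + a * B :=
    (lenr_le_add_mul hK hr0.le ha.le).trans (by gcongr)
  have h2 : lenr L a b ≤ b + a * B := by
    have hsymm : lenr L a b = lenr L b a := by unfold lenr; ring_nf
    rw [hsymm]
    exact (lenr_le_add_mul hL hb.le ha.le).trans (by gcongr)
  have h3 : lenr J r0 b ≤ r0 + b + s := by linarith
  have h4 : r0 ^ 2 + b ^ 2 + 2 * r0 * b * J ≤ (r0 + b + s) ^ 2 := by
    rw [← lenr_sq (by linarith) hr0.le hb.le]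
    exact pow_le_pow_left₀ (Real.sqrt_nonneg _) h3 2
  have hsm : s ≤ r0 * m / 2 := by linarith
  have hsr : s ≤ r0 := by nlinarith
  have h5 : 2 * (r0 * b) * m ≤ 2 * (r0 * b) * (J - 1) := by gcongr
  have h6 : b * s ≤ b * (r0 * m / 2) := by gcongr
  have h7 : s * s ≤ r0 * s := by gcongr
  have h8 : r0 * (b * m) ≤ r0 * (3 * s) := by nlinarith
  linarith [le_of_mul_le_mul_left h8 hr0]

theorem ang0_le {a b c ρ θ : ℝ} (hρ : 0 < ρ) (ha : ρ ≤ a) (hb : ρ ≤ b) (hθ0 : 0 ≤ θ)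
    (hθ : θ ≤ Real.pi) (hc : c ^ 2 ≤ 2 * ρ ^ 2 * (1 - Real.cos θ)) : ang0 a b c ≤ θ := by
  unfold ang0
  rw [← Real.arccos_cos hθ0 hθ]
  refine Real.antitone_arccos ?_
  have ha0 : 0 < a := hρ.trans_le ha
  have hb0 : 0 < b := hρ.trans_le hb
  have hab : ρ ^ 2 ≤ a * b := by rw [sq]; gcongr
  rw [le_div_iff₀ (by positivity)]
  nlinarith [mul_le_mul_of_nonneg_right hab (sub_nonneg.2 (Real.cos_le_one θ)), sq_nonneg (a - b)]

open Fin.CommRing in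
theorem Fin.val_nsmul_one {n : ℕ} [NeZero n] (i : Fin n) : i.val • (1 : Fin n) = i := by
  rw [nsmul_one, Fin.cast_val_eq_self]

/-- Lemma 3.4 (Ring lemma): for the star triangulation of an `n`-gon with weights
`I(e) > 1`, there is a constant `C = C(I, n) > 0` such that every generalized
inversive distance circle packing that is flat at the interior vertex
(`K₀(r) = 0`) satisfies `r₀ ≤ C·rᵢ` for all boundary vertices `vᵢ`. -/
theorem stmt_15 {n : ℕ} [NeZero n] (hn : 3 ≤ n) (I0 Ib : Fin n → ℝ)
    (hI0 : ∀ i, 1 < I0 i) (hIb : ∀ i, 1 < Ib i) :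
    ∃ C : ℝ, 0 < C ∧
      ∀ (r0 : ℝ) (r : Fin n → ℝ), 0 < r0 → (∀ i, 0 < r i) →
        genPacking I0 Ib r0 r → curv0 I0 Ib r0 r = 0 →
        ∀ i, r0 ≤ C * r i := by
  obtain ⟨i₁, hi₁⟩ := Finite.exists_max I0
  obtain ⟨i₂, hi₂⟩ := Finite.exists_max Ib
  obtain ⟨i₃, hi₃⟩ := Finite.exists_min I0
  set B := max (I0 i₁) (Ib i₂)
  set m := min (I0 i₃ - 1) 1
  have hB0 : ∀ i, I0 i ≤ B := fun i => (hi₁ i).trans (le_max_left _ _)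
  have hBb : ∀ i, Ib i ≤ B := fun i => (hi₂ i).trans (le_max_right _ _)
  have hB : 1 ≤ B := (hI0 i₁).le.trans (hB0 i₁)
  have hm : 0 < m := lt_min (by linarith [hI0 i₃]) one_pos
  have hm1 : m ≤ 1 := min_le_right _ _
  have hmI : ∀ i, m ≤ I0 i - 1 := fun i =>
    (min_le_left _ _).trans (by linarith [hi₃ i])
  have hn0 : (3 : ℝ) ≤ n := by exact_mod_cast hn
  set θ := Real.pi / n with hθ
  have hθ0 : 0 < θ := div_pos Real.pi_pos (by linarith)
  have hθπ : θ ≤ Real.pi := div_le_self Real.pi_pos.le (by linarith)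
  set κ := 1 - Real.cos θ with hκ
  have hκ0 : 0 < κ := by
    have := Real.cos_lt_cos_of_nonneg_of_le_pi le_rfl hθπ hθ0
    rw [Real.cos_zero] at this
    linarith
  set M := 6 * B / m with hM
  have hM1 : 1 ≤ M := by rw [hM, le_div_iff₀ hm]; linarith
  obtain ⟨δ, hδ, hδ1, hδm, hδκ⟩ :
      ∃ δ : ℝ, 0 < δ ∧ δ ≤ 1 ∧ 4 * B * δ ≤ m ∧ (1 + B) * δ ≤ κ := by
    refine ⟨min 1 (min (m / (4 * B)) (κ / (1 + B))), by positivity, min_le_left _ _, ?_, ?_⟩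
    · rw [mul_comm, ← le_div_iff₀ (by positivity)]
      exact (min_le_right _ _).trans (min_le_left _ _)
    · rw [mul_comm, ← le_div_iff₀ (by positivity)]
      exact (min_le_right _ _).trans (min_le_right _ _)
  refine ⟨M ^ n / δ, by positivity, fun r0 r hr0 hr hpack hcurv i => ?_⟩
  by_contra! hlt
  have hi : M ^ n * r i ≤ δ * r0 := by
    rw [div_mul_eq_mul_div, div_lt_iff₀ hδ] at hlt
    linarith
  have hchain : ∀ k : ℕ, k ≤ n → r (i + k • (1 : Fin n)) ≤ M ^ k * r i := by
    intro k
    induction k with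
    | zero => intro _; simp
    | succ k ih =>
      intro hk
      have ihk := ih (by omega)
      set j := i + k • (1 : Fin n) with hj
      have hjδ : r j ≤ δ * r0 := ihk.trans
        ((mul_le_mul_of_nonneg_right (pow_le_pow_right₀ hM1 (by omega)) (hr i).le).trans hi)
      have hsmall : 4 * B * r j ≤ m * r0 := by
        calc 4 * B * r j ≤ 4 * B * (δ * r0) := by gcongr
          _ = 4 * B * δ * r0 := by ring
          _ ≤ m * r0 := by gcongr
      have hstep := mul_le_of_lenr_le hm (by linarith) (hmI (j + 1)) (hI0 j).le (hIb j).le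
        (hB0 j) (hBb j) hr0 (hr j) (hr (j + 1)) hsmall (hpack j).2.1
      have hsucc : i + (k + 1) • (1 : Fin n) = j + 1 := by
        rw [hj, succ_nsmul, add_assoc]
      calc r (i + (k + 1) • (1 : Fin n)) = r (j + 1) := by rw [hsucc]
        _ ≤ M * r j := by
          rw [hM, div_mul_eq_mul_div, le_div_iff₀ hm]; exact hstep
        _ ≤ M * (M ^ k * r i) := by gcongr
        _ = M ^ (k + 1) * r i := by ring
  have hall : ∀ j, r j ≤ δ * r0 := by
    intro j
    have h := hchain (j - i).val (j - i).isLt.le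
    rw [Fin.val_nsmul_one, add_sub_cancel] at h
    exact h.trans ((mul_le_mul_of_nonneg_right
      (pow_le_pow_right₀ hM1 (j - i).isLt.le) (hr i).le).trans hi)
  have hang : ∀ j, ang0 (spoke I0 r0 r j) (spoke I0 r0 r (j + 1)) (bd Ib r j) ≤ θ := by
    intro j
    refine ang0_le hr0 (le_lenr (hI0 j).le hr0.le (hr j).le)
      (le_lenr (hI0 _).le hr0.le (hr _).le) hθ0.le hθπ ?_
    have hj := hr j
    have hj1 := hr (j + 1)
    have hIbj := (hIb j).le
    calc bd Ib r j ^ 2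
        = r j ^ 2 + r (j + 1) ^ 2 + 2 * r j * r (j + 1) * Ib j := lenr_sq hIbj hj.le hj1.le
      _ ≤ (δ * r0) ^ 2 + (δ * r0) ^ 2 + 2 * (δ * r0) * (δ * r0) * B := by
          gcongr
          exacts [hall j, hall (j + 1), hall j, hall (j + 1), hBb j]
      _ = 2 * r0 ^ 2 * (δ * ((1 + B) * δ)) := by ring
      _ ≤ 2 * r0 ^ 2 * (1 * κ) := by gcongr
      _ = 2 * r0 ^ 2 * κ := by ring
  have hsum : ∑ j : Fin n, ang0 (spoke I0 r0 r j) (spoke I0 r0 r (j + 1)) (bd Ib r j)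
      ≤ Real.pi := by
    calc _ ≤ ∑ _j : Fin n, θ := Finset.sum_le_sum fun j _ => hang j
      _ = Real.pi := by
        rw [Finset.sum_const, Finset.card_univ, Fintype.card_fin, nsmul_eq_mul, hθ]
        field_simp
  unfold curv0 at hcurv
  linarith [Real.pi_pos]
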